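/- The Hilbert geometry of a triangle (the interior of the convex hull of three affinely independent points in the plane, equipped with the Hilbert distance) is isometric to ℝ² endowed with a norm whose unit ball is a regular hexagon, namely the norm obtained by intersecting the unit cube of (ℝ³, ‖·‖_∞) with the plane {x+y+z = 0}. -/

import Mathlib

open Set Filter MeasureTheory

noncomputable section

abbrev Euc (n : ℕ) := EuclideanSpace ℝ (Fin n)

/-- `Ω` is a convex domain: a non-empty bounded open convex subset of `ℝⁿ`. -/
def IsConvexDomain {n : ℕ} (Ω : Set (Euc n)) : Prop :=
  Ω.Nonempty ∧ IsOpen Ω ∧ Bornology.IsBounded Ω ∧ Convex ℝ Ω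

/-- `d` is the Hilbert distance of the convex domain `Ω` : for distinct `p q ∈ Ω`, if `a` and
`b` are the points where the line through `p` and `q` meets `∂Ω`, in the order `a, p, q, b`
(`a = p + s•(q-p)` with `s < 0`, `b = p + t•(q-p)` with `t > 1`), then
`d p q = ½ log [a,p,q,b]`, and `d p p = 0`. -/
def IsHilbertDist {n : ℕ} (Ω : Set (Euc n)) (d : Euc n → Euc n → ℝ) : Prop :=
  (∀ p ∈ Ω, d p p = 0) ∧
  ∀ p ∈ Ω, ∀ q ∈ Ω, p ≠ q → ∀ a b : Euc n,
    a ∈ frontier Ω → b ∈ frontier Ω →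
    (∃ s t : ℝ, s < 0 ∧ 1 < t ∧ a = p + s • (q - p) ∧ b = p + t • (q - p)) →
    d p q = (1/2) * Real.log ((‖q - a‖ / ‖p - a‖) * (‖p - b‖ / ‖q - b‖))

/-- The sup norm of the halved cyclic differences of a triple is half its oscillation. -/
lemma norm_cyclic_half_sub (u : Fin 3 → ℝ) (M m : Fin 3) (hM : ∀ i, u i ≤ u M)
    (hm : ∀ i, u m ≤ u i) :
    ‖fun i => (u i - u (i + 1)) / 2‖ = (u M - u m) / 2 := by
  apply le_antisymm
  · rw [pi_norm_le_iff_of_nonneg (by linarith [hM m])]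
    intro i
    rw [Real.norm_eq_abs, abs_le]
    constructor <;> linarith [hM i, hm i, hM (i + 1), hm (i + 1)]
  · have key : ∀ i, |(u i - u (i + 1)) / 2| ≤ ‖fun i => (u i - u (i + 1)) / 2‖ :=
      fun i => norm_le_pi_norm (fun i => (u i - u (i + 1)) / 2) i
    have hMm : M = m ∨ m = M + 1 ∨ M = m + 1 := by
      clear hM hm key
      decide +revert
    rcases hMm with rfl | rfl | rfl
    · simp
    · exact (le_abs_self _).trans (key M)
    · exact le_trans (by linarith [neg_abs_le ((u m - u (m + 1)) / 2)]) (key m)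

/-- When passing from a point to a different one, some barycentric coordinate decreases. -/
lemma AffineBasis.exists_coord_lt {ι V : Type*} [Fintype ι] [AddCommGroup V] [Module ℝ V]
    (B : AffineBasis ι ℝ V) {p q : V} (hpq : p ≠ q) : ∃ i, B.coord i q < B.coord i p := by
  by_contra! h
  refine hpq (B.ext_elem fun i => ?_)
  have hsum : ∑ i, B.coord i p = ∑ i, B.coord i q := by
    rw [B.sum_coord_apply_eq_one, B.sum_coord_apply_eq_one]
  exact (Finset.sum_eq_sum_iff_of_le fun i _ => h i).1 hsum i (Finset.mem_univ i)

lemma AffineBasis.coord_add_smul_sub {ι V : Type*} [AddCommGroup V] [Module ℝ V]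
    (B : AffineBasis ι ℝ V) (i : ι) (p q : V) (s : ℝ) :
    B.coord i (p + s • (q - p)) = B.coord i p + s * (B.coord i q - B.coord i p) := by
  have h := (B.coord i).apply_lineMap p q s
  rw [AffineMap.lineMap_apply, AffineMap.lineMap_apply] at h
  simp only [vsub_eq_sub, vadd_eq_add, smul_eq_mul] at h
  rw [add_comm p, h, add_comm]

/-- A point of a simplex with a vanishing barycentric coordinate is a frontier point of its
interior. -/
lemma AffineBasis.mem_frontier_interior_convexHull {ι V : Type*} [Fintype ι]
    [NormedAddCommGroup V] [NormedSpace ℝ V] (B : AffineBasis ι ℝ V) {a : V}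
    (ha : ∀ i, 0 ≤ B.coord i a) {j : ι} (hj : B.coord j a = 0) :
    a ∈ frontier (interior (convexHull ℝ (range B))) := by
  rw [frontier, interior_interior,
    (convex_convexHull ℝ _).closure_interior_eq_closure_of_nonempty_interior
      ⟨_, B.centroid_mem_interior_convexHull⟩]
  refine ⟨subset_closure ?_, fun h => ?_⟩
  · rw [B.convexHull_eq_nonneg_coord]
    exact ha
  · rw [B.interior_convexHull] at h
    exact (h j).ne' hj

/-- The Hilbert distance of an open simplex in terms of the extremal ratios of barycentric
coordinates. -/
lemma IsHilbertDist.eq_log_coord_ratio {n : ℕ} {ι : Type*} [Fintype ι]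
    (B : AffineBasis ι ℝ (Euc n)) {d : Euc n → Euc n → ℝ}
    (hd : IsHilbertDist (interior (convexHull ℝ (range B))) d) {p q : Euc n}
    (hp : ∀ i, 0 < B.coord i p) (hq : ∀ i, 0 < B.coord i q) (hpq : p ≠ q) {M m : ι}
    (hM : ∀ i, B.coord i q / B.coord i p ≤ B.coord M q / B.coord M p)
    (hm : ∀ i, B.coord m q / B.coord m p ≤ B.coord i q / B.coord i p) :
    d p q = (1 / 2) *
      Real.log ((B.coord M q / B.coord M p) / (B.coord m q / B.coord m p)) := by
  set r : ι → ℝ := fun i => B.coord i q / B.coord i p with hr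
  have hrpos : ∀ i, 0 < r i := fun i => div_pos (hq i) (hp i)
  have hqr : ∀ i, B.coord i q = r i * B.coord i p := fun i =>
    (div_mul_cancel₀ _ (hp i).ne').symm
  have hm1 : r m < 1 := by
    obtain ⟨i, hi⟩ := B.exists_coord_lt hpq
    exact (hm i).trans_lt ((div_lt_one (hp i)).2 hi)
  have hM1 : 1 < r M := by
    obtain ⟨i, hi⟩ := B.exists_coord_lt hpq.symm
    exact ((one_lt_div (hp i)).2 hi).trans_le (hM i)
  have hcoord : ∀ (s : ℝ) (i : ι),
      B.coord i (p + s • (q - p)) = B.coord i p * (1 + s * (r i - 1)) := by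
    intro s i
    rw [B.coord_add_smul_sub, hqr]
    ring
  have hs : 1 / (1 - r M) < 0 := one_div_neg.2 (by linarith)
  have ht : 1 < 1 / (1 - r m) := (one_lt_div (by linarith)).2 (by linarith [hrpos m])
  have hsM : 1 / (1 - r M) * (r M - 1) = -1 := by
    have : 1 - r M ≠ 0 := by linarith
    field_simp
    ring
  have htm : 1 / (1 - r m) * (r m - 1) = -1 := by
    have : 1 - r m ≠ 0 := by linarith
    field_simp
    ring
  have ha : p + (1 / (1 - r M)) • (q - p) ∈ frontier (interior (convexHull ℝ (range B))) := by
    refine B.mem_frontier_interior_convexHull (fun i => ?_) (j := M) ?_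
    · rw [hcoord]
      have h1 : r i ≤ r M := hM i
      exact mul_nonneg (hp i).le (by nlinarith)
    · rw [hcoord, hsM]
      ring
  have hb : p + (1 / (1 - r m)) • (q - p) ∈ frontier (interior (convexHull ℝ (range B))) := by
    refine B.mem_frontier_interior_convexHull (fun i => ?_) (j := m) ?_
    · rw [hcoord]
      have h1 : r m ≤ r i := hm i
      exact mul_nonneg (hp i).le (by nlinarith)
    · rw [hcoord, htm]
      ring
  rw [hd.2 p (by rw [B.interior_convexHull]; exact hp) q (by rw [B.interior_convexHull]; exact hq)
    hpq _ _ ha hb ⟨_, _, hs, ht, rfl, rfl⟩]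
  have hN : ‖q - p‖ ≠ 0 := norm_ne_zero_iff.2 (sub_ne_zero.2 hpq.symm)
  have hnp : ∀ s : ℝ, ‖p - (p + s • (q - p))‖ = |s| * ‖q - p‖ := by
    intro s
    rw [sub_add_cancel_left, norm_neg, norm_smul, Real.norm_eq_abs]
  have hnq : ∀ s : ℝ, ‖q - (p + s • (q - p))‖ = |1 - s| * ‖q - p‖ := by
    intro s
    rw [← Real.norm_eq_abs, ← norm_smul]
    congr 1
    module
  congr 2
  rw [hnp, hnp, hnq, hnq, mul_div_mul_right _ _ hN, mul_div_mul_right _ _ hN,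
    abs_of_neg hs, abs_of_pos (by linarith : 0 < 1 - 1 / (1 - r M)),
    abs_of_pos (by linarith : 0 < 1 / (1 - r m)), abs_of_neg (by linarith)]
  have h1 : 1 - r M ≠ 0 := by linarith
  have h2 : 1 - r m ≠ 0 := by linarith
  have h3 := (hrpos m).ne'
  have h4 : -(1 - 1 / (1 - r m)) = r m / (1 - r m) := by
    field_simp
    ring
  have h5 : 1 - 1 / (1 - r M) = -(r M / (1 - r M)) := by
    field_simp
    ring
  change _ = r M / r m
  rw [h4, h5]
  field_simp

/-- The halved cyclic differences of the logarithms of the barycentric coordinates. -/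
def logCoord {V : Type*} [AddCommGroup V] [Module ℝ V] (B : AffineBasis (Fin 3) ℝ V) (x : V) :
    Fin 3 → ℝ :=
  fun i => (Real.log (B.coord i x) - Real.log (B.coord (i + 1) x)) / 2

lemma norm_logCoord_sub {V : Type*} [AddCommGroup V] [Module ℝ V]
    (B : AffineBasis (Fin 3) ℝ V) {p q : V}
    (hp : ∀ i, 0 < B.coord i p) (hq : ∀ i, 0 < B.coord i q) {M m : Fin 3}
    (hM : ∀ i, B.coord i q / B.coord i p ≤ B.coord M q / B.coord M p)
    (hm : ∀ i, B.coord m q / B.coord m p ≤ B.coord i q / B.coord i p) :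
    ‖logCoord B p - logCoord B q‖ = (1 / 2) *
      Real.log ((B.coord M q / B.coord M p) / (B.coord m q / B.coord m p)) := by
  have hrpos : ∀ i, 0 < B.coord i q / B.coord i p := fun i => div_pos (hq i) (hp i)
  have h := norm_cyclic_half_sub (fun i => Real.log (B.coord i q / B.coord i p)) M m
    (fun i => Real.log_le_log (hrpos i) (hM i)) (fun i => Real.log_le_log (hrpos m) (hm i))
  rw [Real.log_div (hrpos M).ne' (hrpos m).ne', one_div_mul_eq_div, ← h, norm_sub_rev]
  congr 1
  ext i
  simp only [logCoord, Pi.sub_apply]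
  rw [Real.log_div (hq _).ne' (hp _).ne', Real.log_div (hq _).ne' (hp _).ne']
  ring

lemma surjOn_logCoord {V : Type*} [AddCommGroup V] [Module ℝ V]
    (B : AffineBasis (Fin 3) ℝ V) :
    SurjOn (logCoord B) {x | ∀ i, 0 < B.coord i x}
      {v : Fin 3 → ℝ | v 0 + v 1 + v 2 = 0} := by
  intro v hv
  have hv : v 0 + v 1 + v 2 = 0 := hv
  set w : Fin 3 → ℝ := ![2 * v 0, 0, -2 * v 1] with hw
  have hc : 0 < ∑ i, Real.exp (w i) :=
    Finset.sum_pos (fun i _ => Real.exp_pos _) Finset.univ_nonempty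
  have hsum : ∑ i, Real.exp (w i) / ∑ j, Real.exp (w j) = 1 := by
    rw [← Finset.sum_div, div_self hc.ne']
  have hx : ∀ i, B.coord i (Finset.univ.affineCombination ℝ B
      fun i => Real.exp (w i) / ∑ j, Real.exp (w j)) = Real.exp (w i) / ∑ j, Real.exp (w j) :=
    fun i => B.coord_apply_combination_of_mem (Finset.mem_univ i) hsum
  refine ⟨_, fun i => (hx i).symm ▸ div_pos (Real.exp_pos _) hc, ?_⟩
  ext i
  simp only [logCoord]
  rw [hx, hx, Real.log_div (Real.exp_ne_zero _) hc.ne', Real.log_div (Real.exp_ne_zero _) hc.ne',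
    Real.log_exp, Real.log_exp]
  fin_cases i <;> simp [hw] <;> linarith

/-- The Hilbert geometry of a triangle is isometric to `ℝ²` endowed with a norm whose unit ball
is a regular hexagon: namely, it is isometric to the plane `{x + y + z = 0}` inside
`(ℝ³, ‖·‖_∞)` with the restricted sup norm, whose unit ball is the intersection of the unit
cube of `(ℝ³, ‖·‖_∞)` with that plane, a regular hexagon. -/
theorem triangle_isometric_to_hexagonal_norm
    (e : Fin 3 → Euc 2) (he : AffineIndependent ℝ e)
    (S : Set (Euc 2)) (hS : S = convexHull ℝ (Set.range e))
    (d : Euc 2 → Euc 2 → ℝ) (hd : IsHilbertDist (interior S) d) :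
    ∃ f : Euc 2 → (Fin 3 → ℝ),
      Set.BijOn f (interior S) {v : Fin 3 → ℝ | v 0 + v 1 + v 2 = 0} ∧
      ∀ x ∈ interior S, ∀ y ∈ interior S, ‖f x - f y‖ = d x y := by
  let B : AffineBasis (Fin 3) ℝ (Euc 2) :=
    ⟨e, he, he.affineSpan_eq_top_iff_card_eq_finrank_add_one.2 (by simp)⟩
  have hSB : S = convexHull ℝ (range B) := hS
  have hint : interior S = {x | ∀ i, 0 < B.coord i x} := by rw [hSB, B.interior_convexHull]
  have hd' : IsHilbertDist (interior (convexHull ℝ (range B))) d := hSB ▸ hd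
  refine ⟨logCoord B, ⟨?_, ?_, hint ▸ surjOn_logCoord B⟩, ?_⟩
  · intro x _
    change (Real.log (B.coord 0 x) - Real.log (B.coord 1 x)) / 2 +
      (Real.log (B.coord 1 x) - Real.log (B.coord 2 x)) / 2 +
      (Real.log (B.coord 2 x) - Real.log (B.coord 0 x)) / 2 = 0
    ring
  · intro x hx y hy hxy
    rw [hint] at hx hy
    by_contra hne
    obtain ⟨M, hM⟩ := Finite.exists_max fun i => B.coord i y / B.coord i x
    obtain ⟨m, hm⟩ := Finite.exists_min fun i => B.coord i y / B.coord i x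
    have h := norm_logCoord_sub B hx hy hM hm
    rw [hxy, sub_self, norm_zero] at h
    obtain ⟨i, hi⟩ := B.exists_coord_lt hne
    obtain ⟨j, hj⟩ := B.exists_coord_lt (Ne.symm hne)
    have h1 := (hm i).trans_lt ((div_lt_one (hx i)).2 hi)
    have h2 := ((one_lt_div (hx j)).2 hj).trans_le (hM j)
    have h3 := Real.log_pos ((one_lt_div (div_pos (hy m) (hx m))).2 (h1.trans h2))
    linarith
  · intro x hx y hy
    by_cases hxy : x = y
    · subst hxy
      rw [hd.1 x hx, sub_self, norm_zero]
    rw [hint] at hx hy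
    obtain ⟨M, hM⟩ := Finite.exists_max fun i => B.coord i y / B.coord i x
    obtain ⟨m, hm⟩ := Finite.exists_min fun i => B.coord i y / B.coord i x
    rw [norm_logCoord_sub B hx hy hM hm, hd'.eq_log_coord_ratio B hx hy hxy hM hm]
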